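/- Let t ∈ PT_n be a planar tree and let P_t ⊆ ℝ^{n−1} be its standard weight Loday realization. Any vector v = (v₁,…,v_{n−1}) ∈ ℝ^{n−1} satisfying Σ_{i∈I} v_i ≠ Σ_{j∈J} v_j for all (I,J) ∈ D(n−1) positively orients P_t, and hence defines a bot-top diagonal Δ_{(P_t,v)} of P_t. -/

import Mathlib

open scoped BigOperators

noncomputable section

/-- Vectors in `ℝⁿ`. -/
abbrev Vec (n : ℕ) := Fin n → ℝ

/-- The standard scalar product on `ℝⁿ`. -/
def dot {n : ℕ} (x y : Vec n) : ℝ := ∑ i, x i * y i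

/-- A polytope is the convex hull of a finite set of points. -/
def IsPolytope {n : ℕ} (P : Set (Vec n)) : Prop :=
  ∃ S : Finset (Vec n), P = convexHull ℝ (S : Set (Vec n))

/-- A face of `P`: either `P` itself (take `c = 0`) or the subset of `P` where some linear
functional attains its maximum over `P`. -/
def IsFace {n : ℕ} (P F : Set (Vec n)) : Prop :=
  ∃ c : Vec n, F = {x ∈ P | ∀ y ∈ P, dot c y ≤ dot c x}

/-- Dimension of a subset of `ℝⁿ`: the rank of the direction of its affine span. -/
noncomputable def sdim {n : ℕ} (A : Set (Vec n)) : ℕ :=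
  Module.finrank ℝ (affineSpan ℝ A).direction

/-- The normal cone of a face `F` of `P`. -/
def normalCone {n : ℕ} (P F : Set (Vec n)) : Set (Vec n) :=
  {c | F ⊆ {x ∈ P | ∀ y ∈ P, dot c y ≤ dot c x}}

/-- `coneOf X`: nonnegative linear combinations of finitely many elements of `X`. -/
def coneOf {n : ℕ} (X : Set (Vec n)) : Set (Vec n) :=
  {v | ∃ (k : ℕ) (x : Fin k → Vec n) (l : Fin k → ℝ),
      (∀ i, x i ∈ X) ∧ (∀ i, 0 ≤ l i) ∧ v = ∑ i, l i • x i}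

/-- The reflection `ρ_z P = 2z - P` of `P` with respect to `z`. -/
def reflP {n : ℕ} (z : Vec n) (P : Set (Vec n)) : Set (Vec n) :=
  (fun x => (2 : ℝ) • z - x) '' P

/-- An edge is a 1-dimensional face. -/
def IsEdge {n : ℕ} (P E : Set (Vec n)) : Prop := IsFace P E ∧ sdim E = 1

/-- `(P, v)` is oriented if `v` is not perpendicular to any edge of `P`. -/
def Oriented {n : ℕ} (P : Set (Vec n)) (v : Vec n) : Prop :=
  ∀ E, IsEdge P E → ∀ d ∈ (affineSpan ℝ E).direction, d ≠ 0 → dot d v ≠ 0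

/-- `(P, v)` is positively oriented if `(P ∩ ρ_z P, v)` is oriented for every `z ∈ P`. -/
def PosOriented {n : ℕ} (P : Set (Vec n)) (v : Vec n) : Prop :=
  ∀ z ∈ P, Oriented (P ∩ reflP z P) v

/-- `x` is the minimizer of `⟨-, v⟩` on `P`. -/
def IsBotOf {n : ℕ} (P : Set (Vec n)) (v x : Vec n) : Prop :=
  x ∈ P ∧ ∀ y ∈ P, dot v x ≤ dot v y

/-- `x` is the maximizer of `⟨-, v⟩` on `P`. -/
def IsTopOf {n : ℕ} (P : Set (Vec n)) (v x : Vec n) : Prop :=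
  x ∈ P ∧ ∀ y ∈ P, dot v y ≤ dot v x

/-- `(P, v)` is quasi-oriented if `⟨-, v⟩` has a unique minimizer and a unique maximizer on `P`. -/
def QuasiOriented {n : ℕ} (P : Set (Vec n)) (v : Vec n) : Prop :=
  (∃! x, IsBotOf P v x) ∧ (∃! x, IsTopOf P v x)

/-- `(P, v)` is quasi-positively oriented if `(P ∩ ρ_z P, v)` is quasi-oriented for all `z ∈ P`. -/
def QuasiPosOriented {n : ℕ} (P : Set (Vec n)) (v : Vec n) : Prop :=
  ∀ z ∈ P, QuasiOriented (P ∩ reflP z P) v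

/-- The polytope `P^φ = π^φ(P × P) ⊆ ℝ^{n+1}`, where `π^φ(x,y) = ((x+y)/2, ⟨x - y, v⟩)`. -/
def Pphi {n : ℕ} (P : Set (Vec n)) (v : Vec n) : Set (Vec (n + 1)) :=
  {w | ∃ x ∈ P, ∃ y ∈ P, w = Fin.snoc ((1 / 2 : ℝ) • (x + y)) (dot (x - y) v)}

/-- The pair of faces `(F, G)` belongs to `F^φ`: there are no `x ∈ F`, `y ∈ G`, `λ > 0` with
`(π(x,y), φ(x,y) - λ) ∈ P^φ`. -/
def InFphi {n : ℕ} (P : Set (Vec n)) (v : Vec n) (F G : Set (Vec n)) : Prop :=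
  ¬ ∃ x ∈ F, ∃ y ∈ G, ∃ lam : ℝ, 0 < lam ∧
      (Fin.snoc ((1 / 2 : ℝ) • (x + y)) (dot (x - y) v - lam) : Vec (n + 1)) ∈ Pphi P v

/-- The set `(A + B)/2`. -/
def avgSet {n : ℕ} (A B : Set (Vec n)) : Set (Vec n) :=
  {z | ∃ x ∈ A, ∃ y ∈ B, z = (1 / 2 : ℝ) • (x + y)}

/-- The coherent subdivision `π(F^φ)` is tight. -/
def TightSub {n : ℕ} (P : Set (Vec n)) (v : Vec n) : Prop :=
  ∀ F G : Set (Vec n), IsFace P F → IsFace P G → F.Nonempty → G.Nonempty →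
    InFphi P v F G → sdim F + sdim G = sdim (avgSet F G)

/-- `d` is a direction of an edge of `P ∩ ρ_z P` for some `z ∈ P`; the hyperplanes of the
fundamental hyperplane arrangement `H_P` are the orthogonal complements of such directions. -/
def EdgeDir {n : ℕ} (P : Set (Vec n)) (d : Vec n) : Prop :=
  d ≠ 0 ∧ ∃ z ∈ P, ∃ E, IsEdge (P ∩ reflP z P) E ∧ d ∈ (affineSpan ℝ E).direction

/-- The cone `cone(-N_P(F) ∪ N_P(G))`. -/
def diagCone {n : ℕ} (P F G : Set (Vec n)) : Set (Vec n) :=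
  coneOf ((Neg.neg '' normalCone P F) ∪ normalCone P G)

/-- A planar rooted tree with `n` internal vertices labelled `0, …, n-1` in the clockwise-from-root
(depth-first preorder) order; `parent v` is the parent of the vertex `v`, the root being vertex `0`.
The internal edge `e : Fin (n-1)` connects the vertex `e+1` to its parent. -/
structure PTree (n : ℕ) where
  parent : Fin n → Fin n
  parent_zero : ∀ v : Fin n, v.val = 0 → parent v = v
  parent_lt : ∀ v : Fin n, 0 < v.val → (parent v).val < v.val
  preorder : ∀ v w : Fin n, w.val = v.val + 1 → ∃ k : ℕ, parent^[k] v = parent w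

/-- The child endpoint of the edge `e`: the vertex labelled `e + 1`. -/
def childV {n : ℕ} (e : Fin (n - 1)) : Fin n :=
  ⟨e.val + 1, by have h := e.isLt; omega⟩

/-- The vertices of the closure of a set of edges `N`, i.e. `V(t(N))`. -/
def nestVtx {n : ℕ} (t : PTree n) (N : Finset (Fin (n - 1))) : Finset (Fin n) :=
  N.biUnion fun e => {childV e, t.parent (childV e)}

/-- Two distinct edges are adjacent when they share a vertex. -/
def edgeAdj {n : ℕ} (t : PTree n) (e f : Fin (n - 1)) : Prop :=
  e ≠ f ∧ (({childV e, t.parent (childV e)} ∩ {childV f, t.parent (childV f)} :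
      Finset (Fin n))).Nonempty

instance {n : ℕ} (t : PTree n) (e f : Fin (n - 1)) : Decidable (edgeAdj t e f) := by
  unfold edgeAdj; infer_instance

/-- A nest: a set of edges whose closure is a connected subgraph (the trivial nest `E(t)` is
also allowed when `n = 1`, where it is empty). -/
def IsNest {n : ℕ} (t : PTree n) (N : Finset (Fin (n - 1))) : Prop :=
  (N.Nonempty ∨ N = Finset.univ) ∧
    ∀ e ∈ N, ∀ f ∈ N,
      Relation.ReflTransGen (fun a b => a ∈ N ∧ b ∈ N ∧ edgeAdj t a b) e f

/-- A nesting: a set of nests containing the trivial nest, any two of which are nested or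
disjoint, disjoint ones having no adjacent edges. -/
def IsNesting {n : ℕ} (t : PTree n) (𝒩 : Finset (Finset (Fin (n - 1)))) : Prop :=
  (∀ N ∈ 𝒩, IsNest t N) ∧ Finset.univ ∈ 𝒩 ∧
    ∀ N ∈ 𝒩, ∀ M ∈ 𝒩,
      N ⊆ M ∨ M ⊆ N ∨ (Disjoint N M ∧ ∀ e ∈ N, ∀ f ∈ M, ¬ edgeAdj t e f)

/-- A maximal nesting: a nesting of (maximal) cardinality `n - 1`. -/
def IsMaxNesting {n : ℕ} (t : PTree n) (𝒩 : Finset (Finset (Fin (n - 1)))) : Prop :=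
  IsNesting t 𝒩 ∧ 𝒩.card = n - 1

/-- `min 𝒩(i)`: the smallest nest of `𝒩` containing the edge `i` (the nests of a nesting
containing `i` being totally ordered, this is their intersection). -/
def minNest {n : ℕ} (𝒩 : Finset (Finset (Fin (n - 1)))) (i : Fin (n - 1)) :
    Finset (Fin (n - 1)) :=
  (𝒩.filter fun N => i ∈ N).inf id

/-- `u` is a weak ancestor of `w` (any ancestor is reached in at most `n` steps). -/
def isAnc {n : ℕ} (t : PTree n) (u w : Fin n) : Prop :=
  ∃ k ∈ Finset.range (n + 1), t.parent^[k] w = u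

instance {n : ℕ} (t : PTree n) (u w : Fin n) : Decidable (isAnc t u w) := by
  unfold isAnc; infer_instance

/-- `α_i`: the total weight of the subtree `t₁` of `t(min𝒩(i))` having the edge `i` as root. -/
def alphaN {n : ℕ} (t : PTree n) (𝒩 : Finset (Finset (Fin (n - 1))))
    (ω : Fin n → ℤ) (i : Fin (n - 1)) : ℤ :=
  ∑ w ∈ (nestVtx t (minNest 𝒩 i)).filter (fun w => isAnc t (childV i) w), ω w

/-- `β_i`: the total weight of the subtree `t₂` of `t(min𝒩(i))` having the edge `i` as a leaf. -/
def betaN {n : ℕ} (t : PTree n) (𝒩 : Finset (Finset (Fin (n - 1))))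
    (ω : Fin n → ℤ) (i : Fin (n - 1)) : ℤ :=
  ∑ w ∈ (nestVtx t (minNest 𝒩 i)).filter (fun w => ¬ isAnc t (childV i) w), ω w

/-- The point `M(t, 𝒩, ω) = (α₁β₁, …, α_{n-1}β_{n-1})`. -/
noncomputable def MPoint {n : ℕ} (t : PTree n) (𝒩 : Finset (Finset (Fin (n - 1))))
    (ω : Fin n → ℤ) : Vec (n - 1) :=
  fun i => ((alphaN t 𝒩 ω i : ℤ) : ℝ) * ((betaN t 𝒩 ω i : ℤ) : ℝ)

/-- The Loday realization `P_{(t,ω)}` of the operahedron. -/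
noncomputable def Loday {n : ℕ} (t : PTree n) (ω : Fin n → ℤ) : Set (Vec (n - 1)) :=
  convexHull ℝ {x | ∃ 𝒩, IsMaxNesting t 𝒩 ∧ x = MPoint t 𝒩 ω}

/-- The face of `P_{(t,ω)}` associated to a nesting `𝒩`: the convex hull of the points
`M(t,𝒩',ω)` over the maximal nestings `𝒩' ⊇ 𝒩`. -/
noncomputable def faceOfNesting {n : ℕ} (t : PTree n) (ω : Fin n → ℤ)
    (𝒩 : Finset (Finset (Fin (n - 1)))) : Set (Vec (n - 1)) :=
  convexHull ℝ {x | ∃ 𝒩', IsMaxNesting t 𝒩' ∧ 𝒩 ⊆ 𝒩' ∧ x = MPoint t 𝒩' ω}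

/-- A pair `(I, J) ∈ D(m)`: disjoint subsets of the same cardinality with `min (I ∪ J) ∈ I`. -/
def DPair {m : ℕ} (I J : Finset (Fin m)) : Prop :=
  I.card = J.card ∧ Disjoint I J ∧ ∃ i ∈ I, ∀ x ∈ I ∪ J, i ≤ x

/-- A trinary vector: all coordinates are `0`, `1` or `-1`. -/
def Trinary {m : ℕ} (u : Vec m) : Prop := ∀ i, u i = 0 ∨ u i = 1 ∨ u i = -1

/-- A balanced vector: same number of coordinates equal to `1` and to `-1`. -/
def BalancedVec {m : ℕ} (u : Vec m) : Prop :=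
  (Finset.univ.filter fun i => u i = 1).card = (Finset.univ.filter fun i => u i = -1).card

/-- The first nonzero coordinate is `1`. -/
def FirstPos {m : ℕ} (u : Vec m) : Prop :=
  ∀ i, u i ≠ 0 → (∀ j, j < i → u j = 0) → u i = 1

section TreePaths

variable {n : ℕ} (t : PTree n)

theorem parent_val_le (w : Fin n) : (t.parent w).val ≤ w.val - 1 := by
  rcases Nat.eq_zero_or_pos w.val with h | h
  · rw [t.parent_zero w h, h]
  · have := t.parent_lt w h
    omega

theorem iterate_parent_val_le (k : ℕ) (w : Fin n) : (t.parent^[k] w).val ≤ w.val - k := by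
  induction k generalizing w with
  | zero => simp
  | succ k ih =>
    rw [Function.iterate_succ_apply]
    have h₁ := ih (t.parent w)
    have h₂ := parent_val_le t w
    omega

theorem isAnc_iff (u w : Fin n) : isAnc t u w ↔ ∃ k, t.parent^[k] w = u := by
  refine ⟨fun ⟨k, _, hk⟩ => ⟨k, hk⟩, fun ⟨k, hk⟩ => ?_⟩
  rcases lt_or_ge k (n + 1) with h | h
  · exact ⟨k, Finset.mem_range.2 h, hk⟩
  · refine ⟨n, Finset.mem_range.2 n.lt_succ_self, ?_⟩
    rw [← hk]
    have h₁ := iterate_parent_val_le t n w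
    have h₂ := iterate_parent_val_le t k w
    have := w.isLt
    ext
    omega

theorem isAnc_refl (u : Fin n) : isAnc t u u := (isAnc_iff t u u).2 ⟨0, rfl⟩

theorem isAnc.val_le {t : PTree n} {u w : Fin n} (h : isAnc t u w) : u.val ≤ w.val := by
  obtain ⟨k, rfl⟩ := (isAnc_iff t u w).1 h
  exact (iterate_parent_val_le t k w).trans (Nat.sub_le _ _)

theorem isAnc_parent_iff {u w : Fin n} (h : u ≠ w) : isAnc t u (t.parent w) ↔ isAnc t u w := by
  simp only [isAnc_iff]
  constructor
  · rintro ⟨k, hk⟩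
    exact ⟨k + 1, hk⟩
  · rintro ⟨k, hk⟩
    cases k with
    | zero => exact absurd hk.symm h
    | succ k => exact ⟨k, hk⟩

theorem childV_injective : Function.Injective (childV : Fin (n - 1) → Fin n) := by
  intro e f h
  have := congrArg Fin.val h
  simp only [childV] at this
  ext
  omega

theorem not_isAnc_parent_childV (e : Fin (n - 1)) :
    ¬ isAnc t (childV e) (t.parent (childV e)) := by
  intro h
  have h₁ := h.val_le
  have h₂ := t.parent_lt (childV e) (Nat.succ_pos _)
  omega

theorem exists_childV_eq {u : Fin n} (h : 0 < u.val) : ∃ e : Fin (n - 1), childV e = u := by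
  refine ⟨⟨u.val - 1, by omega⟩, ?_⟩
  ext
  simp only [childV]
  omega

/-- The edges separating two vertices, i.e. the edges of the path joining them. -/
def sep (u w : Fin n) : Finset (Fin (n - 1)) :=
  Finset.univ.filter fun e => ¬(isAnc t (childV e) u ↔ isAnc t (childV e) w)

/-- The two endpoints of an edge. -/
def ends (e : Fin (n - 1)) : Finset (Fin n) := {childV e, t.parent (childV e)}

variable {t}

theorem mem_sep {u w : Fin n} {e : Fin (n - 1)} :
    e ∈ sep t u w ↔ ¬(isAnc t (childV e) u ↔ isAnc t (childV e) w) := by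
  simp [sep]

theorem mem_ends {v : Fin n} {e : Fin (n - 1)} :
    v ∈ ends t e ↔ v = childV e ∨ v = t.parent (childV e) := by
  simp [ends]

theorem mem_nestVtx {N : Finset (Fin (n - 1))} {v : Fin n} :
    v ∈ nestVtx t N ↔ ∃ e ∈ N, v ∈ ends t e := by
  simp [nestVtx, ends]

theorem edgeAdj_iff {e f : Fin (n - 1)} :
    edgeAdj t e f ↔ e ≠ f ∧ ∃ v, v ∈ ends t e ∧ v ∈ ends t f := by
  simp only [edgeAdj, Finset.Nonempty, Finset.mem_inter, ends]

theorem nestVtx_mono {N M : Finset (Fin (n - 1))} (h : N ⊆ M) : nestVtx t N ⊆ nestVtx t M :=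
  Finset.biUnion_subset_biUnion_of_subset_left _ h

theorem sep_comm (u w : Fin n) : sep t u w = sep t w u := by
  ext e
  simp only [mem_sep]
  tauto

theorem sep_self (u : Fin n) : sep t u u = ∅ := by
  simp [sep]

theorem sep_subset_union (u v w : Fin n) : sep t u w ⊆ sep t u v ∪ sep t v w := by
  intro e
  simp only [mem_sep, Finset.mem_union]
  tauto

theorem sep_childV {e : Fin (n - 1)} {w : Fin n} (h : ¬ isAnc t (childV e) w) :
    sep t (childV e) w = insert e (sep t (t.parent (childV e)) w) := by
  ext f
  simp only [mem_sep, Finset.mem_insert]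
  by_cases hf : f = e
  · subst hf
    simp [h, isAnc_refl]
  · rw [isAnc_parent_iff t fun h => hf (childV_injective h)]
    simp [hf]

theorem sep_ends (e : Fin (n - 1)) : sep t (childV e) (t.parent (childV e)) = {e} := by
  rw [sep_childV (not_isAnc_parent_childV t e), sep_self]
  rfl

theorem sep_subset_of_mem_ends {e : Fin (n - 1)} {u w : Fin n} (hu : u ∈ ends t e)
    (hw : w ∈ ends t e) : sep t u w ⊆ {e} := by
  rcases mem_ends.1 hu with rfl | rfl <;> rcases mem_ends.1 hw with rfl | rfl
  · simp [sep_self]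
  · rw [sep_ends]
  · rw [sep_comm, sep_ends]
  · simp [sep_self]

variable (t) in
/-- Two edges are linked in `N` when they are joined by a chain of adjacent edges of `N`. -/
def Linked (N : Finset (Fin (n - 1))) : Fin (n - 1) → Fin (n - 1) → Prop :=
  Relation.ReflTransGen fun a b => a ∈ N ∧ b ∈ N ∧ edgeAdj t a b

theorem Linked.mono {N M : Finset (Fin (n - 1))} (h : N ⊆ M) {e f : Fin (n - 1)}
    (hef : Linked t N e f) : Linked t M e f :=
  Relation.ReflTransGen.mono (fun _ _ hab => ⟨h hab.1, h hab.2.1, hab.2.2⟩) _ _ hef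

theorem Linked.symm {N : Finset (Fin (n - 1))} {e f : Fin (n - 1)}
    (hef : Linked t N e f) : Linked t N f e := by
  refine Relation.ReflTransGen.mono (fun a b hab => ⟨hab.2.1, hab.1, ?_⟩) _ _ hef.swap
  obtain ⟨hne, v, hva, hvb⟩ := edgeAdj_iff.1 hab.2.2
  exact edgeAdj_iff.2 ⟨hne.symm, v, hvb, hva⟩

theorem linked_of_share {N : Finset (Fin (n - 1))} {e f : Fin (n - 1)} (he : e ∈ N) (hf : f ∈ N)
    {v : Fin n} (hve : v ∈ ends t e) (hvf : v ∈ ends t f) : Linked t N e f := by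
  by_cases h : e = f
  · subst h
    exact Relation.ReflTransGen.refl
  · exact Relation.ReflTransGen.single ⟨he, hf, edgeAdj_iff.2 ⟨h, v, hve, hvf⟩⟩

/-- The separating edges of two distinct vertices form a path joining them. -/
theorem sep_path (u w : Fin n) (h : u ≠ w) :
    (∃ e ∈ sep t u w, u ∈ ends t e) ∧ (∃ e ∈ sep t u w, w ∈ ends t e) ∧
      ∀ e ∈ sep t u w, ∀ f ∈ sep t u w, Linked t (sep t u w) e f := by
  induction hs : u.val + w.val using Nat.strong_induction_on generalizing u w with
  | _ s ih =>
  wlog huw : w.val < u.val generalizing u w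
  · have hwu : u.val < w.val := by
      have : u.val ≠ w.val := fun h' => h (Fin.ext h')
      omega
    obtain ⟨h₁, h₂, h₃⟩ := this w u h.symm (by omega) hwu
    rw [sep_comm]
    exact ⟨h₂, h₁, h₃⟩
  · obtain ⟨e, rfl⟩ := exists_childV_eq (u := u) (by omega)
    have hanc : ¬ isAnc t (childV e) w := fun h' => by
      have := h'.val_le
      omega
    have hp := t.parent_lt (childV e) (by omega)
    rw [sep_childV hanc]
    by_cases hpw : t.parent (childV e) = w
    · rw [hpw, sep_self]
      refine ⟨⟨e, by simp, mem_ends.2 (Or.inl rfl)⟩, ⟨e, by simp, mem_ends.2 (Or.inr hpw.symm)⟩, ?_⟩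
      simp only [insert_empty_eq, Finset.mem_singleton]
      rintro a rfl b rfl
      exact Relation.ReflTransGen.refl
    · obtain ⟨⟨a, ha, hpa⟩, ⟨b, hb, hwb⟩, hl⟩ := ih _ (by omega) _ _ hpw rfl
      refine ⟨⟨e, Finset.mem_insert_self _ _, mem_ends.2 (Or.inl rfl)⟩,
        ⟨b, Finset.mem_insert_of_mem hb, hwb⟩, ?_⟩
      have key : ∀ f ∈ insert e (sep t (t.parent (childV e)) w),
          Linked t (insert e (sep t (t.parent (childV e)) w)) f a := by
        intro f hf
        rcases Finset.mem_insert.1 hf with rfl | hf'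
        · exact linked_of_share hf (Finset.mem_insert_of_mem ha) (mem_ends.2 (Or.inr rfl)) hpa
        · exact (hl f hf' a ha).mono (Finset.subset_insert _ _)
      exact fun f hf g hg => (key f hf).trans (key g hg).symm

variable (t) in
/-- A set of edges is path-convex if it contains all paths between its vertices. -/
def PathConvex (N : Finset (Fin (n - 1))) : Prop :=
  ∀ u ∈ nestVtx t N, ∀ w ∈ nestVtx t N, sep t u w ⊆ N

theorem pathConvex_of_linked {N : Finset (Fin (n - 1))}
    (h : ∀ e ∈ N, ∀ f ∈ N, Linked t N e f) : PathConvex t N := by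
  intro u hu w hw
  obtain ⟨e, he, hue⟩ := mem_nestVtx.1 hu
  obtain ⟨f, hf, hwf⟩ := mem_nestVtx.1 hw
  have hl := h e he f hf
  clear hw
  induction hl generalizing w with
  | refl => exact (sep_subset_of_mem_ends hue hwf).trans (by simpa using he)
  | tail _ hbc ih =>
    obtain ⟨hb, _, hadj⟩ := hbc
    obtain ⟨_, v, hvb, hvc⟩ := edgeAdj_iff.1 hadj
    exact (sep_subset_union u v w).trans (Finset.union_subset (ih v hb hvb)
      ((sep_subset_of_mem_ends hvc hwf).trans (by simpa using hf)))

theorem PathConvex.linked {N : Finset (Fin (n - 1))} (h : PathConvex t N) :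
    ∀ e ∈ N, ∀ f ∈ N, Linked t N e f := by
  intro e he f hf
  by_cases hef : e = f
  · subst hef
    exact Relation.ReflTransGen.refl
  have hce : childV e ∈ ends t e := mem_ends.2 (Or.inl rfl)
  have hcf : childV f ∈ ends t f := mem_ends.2 (Or.inl rfl)
  have hsub := h _ (mem_nestVtx.2 ⟨e, he, hce⟩) _ (mem_nestVtx.2 ⟨f, hf, hcf⟩)
  obtain ⟨⟨a, ha, hea⟩, ⟨b, hb, hfb⟩, hl⟩ :=
    sep_path (t := t) (childV e) (childV f) fun h' => hef (childV_injective h')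
  exact ((linked_of_share he (hsub ha) hce hea).trans ((hl a ha b hb).mono hsub)).trans
    (linked_of_share (hsub hb) hf hfb hcf)

theorem isNest_of_pathConvex {N : Finset (Fin (n - 1))} (hne : N.Nonempty) (h : PathConvex t N) :
    IsNest t N := ⟨Or.inl hne, h.linked⟩

theorem IsNest.pathConvex {N : Finset (Fin (n - 1))} (h : IsNest t N) : PathConvex t N :=
  pathConvex_of_linked h.2

theorem IsNest.nonempty (hn : 2 ≤ n) {N : Finset (Fin (n - 1))} (h : IsNest t N) :
    N.Nonempty := by
  rcases h.1 with h | rfl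
  · exact h
  · exact ⟨⟨0, by omega⟩, Finset.mem_univ _⟩

theorem left_mem_nestVtx_of_sep_subset {N : Finset (Fin (n - 1))} {u w : Fin n} (h : u ≠ w)
    (hs : sep t u w ⊆ N) : u ∈ nestVtx t N := by
  obtain ⟨e, he, hue⟩ := (sep_path (t := t) u w h).1
  exact mem_nestVtx.2 ⟨e, hs he, hue⟩

theorem right_mem_nestVtx_of_sep_subset {N : Finset (Fin (n - 1))} {u w : Fin n} (h : u ≠ w)
    (hs : sep t u w ⊆ N) : w ∈ nestVtx t N :=
  left_mem_nestVtx_of_sep_subset h.symm (by rwa [sep_comm])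

theorem pathConvex_univ : PathConvex t Finset.univ := fun _ _ _ _ => Finset.subset_univ _

theorem pathConvex_singleton (e : Fin (n - 1)) : PathConvex t {e} :=
  pathConvex_of_linked (by
    simp only [Finset.mem_singleton]
    rintro a rfl b rfl
    exact Relation.ReflTransGen.refl)

theorem PathConvex.inter {N M : Finset (Fin (n - 1))} (hN : PathConvex t N)
    (hM : PathConvex t M) : PathConvex t (N ∩ M) := fun u hu w hw =>
  Finset.subset_inter
    (hN u (nestVtx_mono Finset.inter_subset_left hu) w (nestVtx_mono Finset.inter_subset_left hw))
    (hM u (nestVtx_mono Finset.inter_subset_right hu) w (nestVtx_mono Finset.inter_subset_right hw))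

theorem nestVtx_union (N M : Finset (Fin (n - 1))) :
    nestVtx t (N ∪ M) = nestVtx t N ∪ nestVtx t M := Finset.union_biUnion

theorem PathConvex.union {N M : Finset (Fin (n - 1))} (hN : PathConvex t N)
    (hM : PathConvex t M) {v : Fin n} (hvN : v ∈ nestVtx t N) (hvM : v ∈ nestVtx t M) :
    PathConvex t (N ∪ M) := by
  have key : ∀ u ∈ nestVtx t (N ∪ M), sep t u v ⊆ N ∪ M := by
    intro u hu
    rw [nestVtx_union, Finset.mem_union] at hu
    rcases hu with hu | hu
    · exact (hN u hu v hvN).trans Finset.subset_union_left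
    · exact (hM u hu v hvM).trans Finset.subset_union_right
  intro u hu w hw
  refine (sep_subset_union u v w).trans (Finset.union_subset (key u hu) ?_)
  rw [sep_comm]
  exact key w hw

theorem PathConvex.subset_of_nestVtx_subset {N M : Finset (Fin (n - 1))} (hM : PathConvex t M)
    (h : nestVtx t N ⊆ nestVtx t M) : N ⊆ M := by
  intro e he
  have := hM _ (h (mem_nestVtx.2 ⟨e, he, mem_ends.2 (Or.inl rfl)⟩)) _
    (h (mem_nestVtx.2 ⟨e, he, mem_ends.2 (Or.inr rfl)⟩))
  rw [sep_ends] at this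
  exact this (Finset.mem_singleton_self e)

variable (t) in
/-- The number of ordered pairs of distinct vertices of a set of edges. -/
def pairs (N : Finset (Fin (n - 1))) : ℕ := (nestVtx t N).offDiag.card

/-- The number of pairs of vertices is strictly supermodular on incomparable path-convex sets
which share a vertex. -/
theorem pairs_add_pairs_lt {N M : Finset (Fin (n - 1))} (hN : PathConvex t N)
    (hM : PathConvex t M) (hNM : ¬ N ⊆ M) (hMN : ¬ M ⊆ N) :
    pairs t N + pairs t M < pairs t (N ∪ M) + pairs t (N ∩ M) := by
  obtain ⟨u, hu, hu'⟩ := Finset.not_subset.1 (mt hM.subset_of_nestVtx_subset hNM)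
  obtain ⟨w, hw, hw'⟩ := Finset.not_subset.1 (mt hN.subset_of_nestVtx_subset hMN)
  unfold pairs
  rw [← Finset.card_union_add_card_inter]
  refine add_lt_add_of_lt_of_le (Finset.card_lt_card ?_) (Finset.card_le_card ?_)
  · refine Finset.ssubset_iff_subset_ne.2 ⟨?_, fun h => ?_⟩
    · rw [nestVtx_union]
      exact Finset.union_subset (Finset.offDiag_mono Finset.subset_union_left)
        (Finset.offDiag_mono Finset.subset_union_right)
    · have : (u, w) ∈ (nestVtx t (N ∪ M)).offDiag := by
        rw [nestVtx_union, Finset.mem_offDiag]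
        refine ⟨Finset.mem_union_left _ hu, Finset.mem_union_right _ hw, ?_⟩
        exact fun h' : u = w => hw' (h' ▸ hu)
      rw [← h] at this
      simp [hu', hw'] at this
  · rintro ⟨a, b⟩ h
    simp only [Finset.mem_inter, Finset.mem_offDiag] at h ⊢
    obtain ⟨⟨h₁, h₂, hne⟩, h₃, h₄, _⟩ := h
    have hs := Finset.subset_inter (hN a h₁ b h₂) (hM a h₃ b h₄)
    exact ⟨left_mem_nestVtx_of_sep_subset hne hs, right_mem_nestVtx_of_sep_subset hne hs, hne⟩

end TreePaths

section AlternatingCycle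

/-- Given two partitions of a finite set and a nonzero vector whose sum over each block of both
partitions vanishes, there is such a vector with coordinates in `{0, 1, -1}`: it is the alternating
vector of a cycle in the bipartite graph whose vertices are the blocks. -/
theorem exists_trinary_of_sum_fiber_eq_zero {ι β : Type*} [Fintype ι] [DecidableEq ι]
    [DecidableEq β] (h : Bool → ι → β) (w : ι → ℝ) (hw : w ≠ 0)
    (hs : ∀ p b, ∑ i with h p i = b, w i = 0) :
    ∃ u : ι → ℝ, u ≠ 0 ∧ (∀ i, u i = 0 ∨ u i = 1 ∨ u i = -1) ∧
      ∀ p b, ∑ i with h p i = b, u i = 0 := by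
  have step : ∀ (p : Bool) (i : {i // w i ≠ 0}), ∃ j : {i // w i ≠ 0}, j ≠ i ∧ h p j = h p i := by
    rintro p ⟨i, hi⟩
    by_contra! hc
    refine hi ?_
    rw [← hs p (h p i)]
    refine (Finset.sum_eq_single_of_mem i (by simp) fun j hj hji => ?_).symm
    by_contra hwj
    exact hc ⟨j, hwj⟩ (fun h' => hji (congrArg Subtype.val h')) (Finset.mem_filter.1 hj).2
  choose next hnext_ne hnext using step
  obtain ⟨i₀, hi₀⟩ := Function.ne_iff.1 hw
  obtain ⟨s, hs_ne, hs_eq⟩ : ∃ s : ℕ → ι, (∀ k, s (k + 1) ≠ s k) ∧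
      ∀ k, h k.bodd (s (k + 1)) = h k.bodd (s k) := by
    let x : ℕ → {i // w i ≠ 0} := fun k => Nat.rec ⟨i₀, hi₀⟩ (fun k y => next k.bodd y) k
    exact ⟨fun k => (x k).1, fun k he => hnext_ne k.bodd (x k) (Subtype.ext he),
      fun k => hnext k.bodd (x k)⟩
  have hex : ∃ L : ℕ, 0 < L ∧ ∃ a : ℕ, Nat.bodd a = (a + L).bodd ∧
      h (Nat.bodd a) (s a) = h (Nat.bodd a) (s (a + L)) := by
    obtain ⟨a, b, hab, he⟩ := Finite.exists_ne_map_eq_of_infinite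
      fun k : ℕ => (k.bodd, s k)
    wlog hlt : a < b generalizing a b
    · exact this b a hab.symm he.symm (by omega)
    obtain ⟨he₁, he₂⟩ := Prod.mk.inj he
    refine ⟨b - a, by omega, a, ?_, ?_⟩
    · rw [Nat.add_sub_cancel' hlt.le, he₁]
    · rw [Nat.add_sub_cancel' hlt.le, he₂]
  classical
  obtain ⟨hL, a, hpar, hclose⟩ := Nat.find_spec hex
  have hmin : ∀ l : ℕ, 0 < l → l < Nat.find hex → ∀ a : ℕ, Nat.bodd a = (a + l).bodd →
      h (Nat.bodd a) (s a) ≠ h (Nat.bodd a) (s (a + l)) := fun l hl hlt a h₁ h₂ =>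
    Nat.find_min hex hlt ⟨hl, a, h₁, h₂⟩
  generalize Nat.find hex = L at hL hpar hclose hmin
  have hinj : ∀ k l, k < l → l < L → s (a + k + 1) ≠ s (a + l + 1) := by
    intro k l hkl hlL he
    by_cases hp : Nat.bodd (a + k + 1) = Nat.bodd (a + l + 1)
    · refine hmin (l - k) (by omega) (by omega) (a + k + 1) ?_ ?_ <;>
        rw [show a + k + 1 + (l - k) = a + l + 1 by omega]
      · exact hp
      · rw [he]
    · have hp' : Nat.bodd (a + k + 1) = Nat.bodd (a + l) := by
        rw [Nat.bodd_succ (a + l)] at hp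
        revert hp
        cases Nat.bodd (a + k + 1) <;> cases Nat.bodd (a + l) <;> simp
      rcases Nat.eq_or_lt_of_le (Nat.succ_le_of_lt hkl) with hl | hl
      · subst hl
        exact hs_ne _ he.symm
      · refine hmin (l - (k + 1)) (by omega) (by omega) (a + k + 1) ?_ ?_ <;>
          rw [show a + k + 1 + (l - (k + 1)) = a + l by omega]
        · exact hp'
        · rw [he, hp', hs_eq]
  let u : ι → ℝ := fun i => ∑ k ∈ Finset.range L, if s (a + k + 1) = i then (-1) ^ k else 0
  have hu : ∀ k < L, u (s (a + k + 1)) = (-1) ^ k := by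
    intro k hk
    refine (Finset.sum_eq_single_of_mem k (Finset.mem_range.2 hk) fun l hl hlk => ?_).trans
      (if_pos rfl)
    refine if_neg fun he => ?_
    rcases lt_or_gt_of_ne hlk with h' | h'
    · exact hinj l k h' hk he
    · exact hinj k l h' (Finset.mem_range.1 hl) he.symm
  refine ⟨u, fun h0 => ?_, fun i => ?_, fun p b => ?_⟩
  · have := hu 0 hL
    rw [h0] at this
    simp at this
  · by_cases hi : ∃ k < L, s (a + k + 1) = i
    · obtain ⟨k, hk, rfl⟩ := hi
      rw [hu k hk]
      exact Or.inr (neg_one_pow_eq_or ℝ k)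
    · push Not at hi
      exact Or.inl (Finset.sum_eq_zero fun k hk => if_neg (hi k (Finset.mem_range.1 hk)))
  · let F : ℕ → ℝ := fun k =>
      if Nat.bodd (a + k) = p ∧ h p (s (a + k)) = b then (-1) ^ k else 0
    have hF : ∀ k, (if h p (s (a + k + 1)) = b then (-1 : ℝ) ^ k else 0) = F k - F (k + 1) := by
      intro k
      have he := hs_eq (a + k)
      simp only [F, ← add_assoc, Nat.bodd_succ]
      by_cases hp : Nat.bodd (a + k) = p
      · subst hp
        rw [he]
        simp
      · have hp' : (!Nat.bodd (a + k)) = p := by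
          revert hp
          cases Nat.bodd (a + k) <;> cases p <;> simp
        simp only [hp, hp', false_and, true_and, if_false, pow_succ]
        split_ifs <;> ring
    have hLeven : (-1 : ℝ) ^ L = 1 := by
      have : Nat.bodd L = false := by
        rw [Nat.bodd_add] at hpar
        revert hpar
        cases Nat.bodd a <;> cases Nat.bodd L <;> simp
      refine Even.neg_one_pow ?_
      rw [Nat.even_iff, Nat.mod_two_of_bodd, this]
      rfl
    calc ∑ i with h p i = b, u i
        = ∑ k ∈ Finset.range L, if h p (s (a + k + 1)) = b then (-1 : ℝ) ^ k else 0 := by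
          rw [Finset.sum_comm]
          refine Finset.sum_congr rfl fun k _ => ?_
          rw [Finset.sum_ite_eq]
          simp
      _ = F 0 - F L := by
          rw [Finset.sum_congr rfl fun k _ => hF k, Finset.sum_range_sub']
      _ = 0 := by
          simp only [F, hLeven, pow_zero, add_zero, ← hpar]
          by_cases hp : Nat.bodd a = p
          · subst hp
            simp [hclose]
          · simp [hp]

end AlternatingCycle

section Nestings

variable {n : ℕ} {t : PTree n} {𝒩 : Finset (Finset (Fin (n - 1)))}

theorem minNest_subset {N : Finset (Fin (n - 1))} {i : Fin (n - 1)} (hN : N ∈ 𝒩) (hi : i ∈ N) :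
    minNest 𝒩 i ⊆ N :=
  Finset.inf_le (f := id) (Finset.mem_filter.2 ⟨hN, hi⟩)

theorem IsNesting.minNest_mem_filter (h : IsNesting t 𝒩) (i : Fin (n - 1)) :
    minNest 𝒩 i ∈ 𝒩.filter fun N => i ∈ N := by
  obtain ⟨A, hA, hmin⟩ := Finset.exists_min_image (𝒩.filter fun N => i ∈ N) Finset.card
    ⟨Finset.univ, Finset.mem_filter.2 ⟨h.2.1, Finset.mem_univ i⟩⟩
  have hA' := Finset.mem_filter.1 hA
  suffices minNest 𝒩 i = A by rwa [this]
  refine (minNest_subset hA'.1 hA'.2).antisymm (Finset.le_inf fun B hB => ?_)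
  have hB' := Finset.mem_filter.1 hB
  rcases h.2.2 A hA'.1 B hB'.1 with hAB | hBA | ⟨hdis, -⟩
  · exact hAB
  · exact (Finset.eq_of_subset_of_card_le hBA (hmin B hB)).ge
  · exact absurd hB'.2 (Finset.disjoint_left.1 hdis hA'.2)

theorem IsNesting.minNest_mem (h : IsNesting t 𝒩) (i : Fin (n - 1)) : minNest 𝒩 i ∈ 𝒩 :=
  (Finset.mem_filter.1 (h.minNest_mem_filter i)).1

theorem IsNesting.mem_minNest (h : IsNesting t 𝒩) (i : Fin (n - 1)) : i ∈ minNest 𝒩 i :=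
  (Finset.mem_filter.1 (h.minNest_mem_filter i)).2

theorem IsNesting.exists_subset_minNest (h : IsNesting t 𝒩) {S : Finset (Fin (n - 1))}
    (hS : S.Nonempty) (hl : ∀ e ∈ S, ∀ f ∈ S, Linked t S e f) : ∃ i ∈ S, S ⊆ minNest 𝒩 i := by
  obtain ⟨i, hi, hmax⟩ := Finset.exists_max_image S (fun i => (minNest 𝒩 i).card) hS
  refine ⟨i, hi, fun f hf => ?_⟩
  induction hl i hi f hf with
  | refl => exact h.mem_minNest i
  | @tail b c _ hbc ih =>
    obtain ⟨hb, hc, hadj⟩ := hbc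
    have hbA := ih hb
    by_contra hcA
    rcases h.2.2 _ (h.minNest_mem i) _ (h.minNest_mem c) with hs | hs | ⟨-, hs⟩
    · exact (hmax c hc).not_gt (Finset.card_lt_card
        (Finset.ssubset_iff_of_subset hs |>.2 ⟨c, h.mem_minNest c, hcA⟩))
    · exact hcA (hs (h.mem_minNest c))
    · exact hs b hbA c (h.mem_minNest c) hadj

theorem IsNesting.image_minNest (hn : 2 ≤ n) (h : IsNesting t 𝒩) :
    Finset.univ.image (minNest 𝒩) = 𝒩 := by
  ext N
  simp only [Finset.mem_image, Finset.mem_univ, true_and]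
  constructor
  · rintro ⟨i, rfl⟩
    exact h.minNest_mem i
  · intro hN
    obtain ⟨i, hi, hsub⟩ := h.exists_subset_minNest ((h.1 N hN).nonempty hn) (h.1 N hN).2
    exact ⟨i, (minNest_subset hN hi).antisymm hsub⟩

theorem IsMaxNesting.minNest_injective (hn : 2 ≤ n) (h : IsMaxNesting t 𝒩) :
    Function.Injective (minNest 𝒩) := by
  have hcard : (Finset.univ.image (minNest 𝒩)).card = (Finset.univ : Finset (Fin (n - 1))).card := by
    rw [h.1.image_minNest hn, h.2, Finset.card_univ, Fintype.card_fin]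
  exact fun i j hij => Finset.card_image_iff.1 hcard (Finset.mem_coe.2 (Finset.mem_univ i))
    (Finset.mem_coe.2 (Finset.mem_univ j)) hij

theorem IsNesting.isMaxNesting (hn : 2 ≤ n) (h : IsNesting t 𝒩)
    (hinj : Function.Injective (minNest 𝒩)) : IsMaxNesting t 𝒩 := by
  refine ⟨h, ?_⟩
  conv_lhs => rw [← h.image_minNest hn]
  rw [Finset.card_image_of_injective _ hinj, Finset.card_univ, Fintype.card_fin]

theorem IsNesting.sum_eq_sum_blocks (h : IsNesting t 𝒩) {N : Finset (Fin (n - 1))} (hN : N ∈ 𝒩)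
    (u : Fin (n - 1) → ℝ) :
    ∑ i ∈ N, u i = ∑ C ∈ N.powerset, ∑ i with minNest 𝒩 i = C, u i := by
  have hmaps : ∀ i ∈ N, minNest 𝒩 i ∈ N.powerset := fun i hi =>
    Finset.mem_powerset.2 (minNest_subset hN hi)
  rw [← Finset.sum_fiberwise_of_maps_to hmaps]
  refine Finset.sum_congr rfl fun C hC => Finset.sum_congr ?_ fun _ _ => rfl
  ext i
  simp only [Finset.mem_filter, Finset.mem_univ, true_and, and_iff_right_iff_imp]
  rintro rfl
  exact Finset.mem_powerset.1 hC (h.mem_minNest i)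

theorem IsNesting.sum_block_eq_zero (h : IsNesting t 𝒩) {u : Fin (n - 1) → ℝ}
    (hu : ∀ N ∈ 𝒩, ∑ i ∈ N, u i = 0) (B : Finset (Fin (n - 1))) :
    ∑ i with minNest 𝒩 i = B, u i = 0 := by
  induction B using Finset.strongInduction with
  | H B ih =>
  by_cases hB : ∃ i, minNest 𝒩 i = B
  · obtain ⟨i, hi⟩ := hB
    have hBN : B ∈ 𝒩 := hi ▸ h.minNest_mem i
    rw [← hu B hBN, h.sum_eq_sum_blocks hBN]
    symm
    refine Finset.sum_eq_single_of_mem B (Finset.mem_powerset_self B) fun C hC hCB => ?_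
    exact ih C (Finset.ssubset_iff_subset_ne.2 ⟨Finset.mem_powerset.1 hC, hCB⟩)
  · push Not at hB
    refine Finset.sum_eq_zero fun i hi => ?_
    exact absurd (Finset.mem_filter.1 hi).2 (hB i)

theorem IsNesting.sum_nest_eq_zero (h : IsNesting t 𝒩) {u : Fin (n - 1) → ℝ}
    (hu : ∀ B, ∑ i with minNest 𝒩 i = B, u i = 0) {N : Finset (Fin (n - 1))} (hN : N ∈ 𝒩) :
    ∑ i ∈ N, u i = 0 := by
  rw [h.sum_eq_sum_blocks hN]
  exact Finset.sum_eq_zero fun C _ => hu C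

theorem IsNesting.eq_zero_of_injective (h : IsNesting t 𝒩)
    (hinj : Function.Injective (minNest 𝒩)) {u : Fin (n - 1) → ℝ}
    (hu : ∀ N ∈ 𝒩, ∑ i ∈ N, u i = 0) : u = 0 := by
  funext j
  have := h.sum_block_eq_zero hu (minNest 𝒩 j)
  simpa [hinj.eq_iff, Finset.filter_eq'] using this

variable (t 𝒩) in
/-- The ordered pairs of vertices of `min 𝒩(i)` separated by the edge `i`. -/
def separatedPairs (i : Fin (n - 1)) : Finset (Fin n × Fin n) :=
  (nestVtx t (minNest 𝒩 i)).offDiag.filter fun p => i ∈ sep t p.1 p.2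

theorem two_mul_MPoint (i : Fin (n - 1)) :
    2 * MPoint t 𝒩 (fun _ => (1 : ℤ)) i = ((separatedPairs t 𝒩 i).card : ℝ) := by
  set V := nestVtx t (minNest 𝒩 i) with hV
  set A := V.filter fun w => isAnc t (childV i) w with hA
  set B := V.filter fun w => ¬ isAnc t (childV i) w with hB
  have hAB : separatedPairs t 𝒩 i = A ×ˢ B ∪ B ×ˢ A := by
    ext ⟨a, b⟩
    simp only [separatedPairs, ← hV, hA, hB, Finset.mem_filter, Finset.mem_offDiag, mem_sep,
      Finset.mem_union, Finset.mem_product]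
    constructor
    · tauto
    · rintro (⟨⟨h₁, h₂⟩, h₃, h₄⟩ | ⟨⟨h₁, h₂⟩, h₃, h₄⟩)
      · exact ⟨⟨h₁, h₃, fun h => h₄ (h ▸ h₂)⟩, by tauto⟩
      · exact ⟨⟨h₁, h₃, fun h => h₂ (h ▸ h₄)⟩, by tauto⟩
  have hdis : Disjoint (A ×ˢ B) (B ×ˢ A) := by
    rw [Finset.disjoint_left]
    rintro ⟨a, b⟩ h₁ h₂
    exact (Finset.mem_filter.1 (Finset.mem_product.1 h₂).1).2
      (Finset.mem_filter.1 (Finset.mem_product.1 h₁).1).2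
  have hα : alphaN t 𝒩 (fun _ => (1 : ℤ)) i = A.card := by simp [alphaN, hA, hV]
  have hβ : betaN t 𝒩 (fun _ => (1 : ℤ)) i = B.card := by simp [betaN, hB, hV]
  rw [hAB, Finset.card_union_of_disjoint hdis, Finset.card_product, Finset.card_product, MPoint,
    hα, hβ]
  push_cast
  ring

theorem two_mul_sum_MPoint (N : Finset (Fin (n - 1))) :
    2 * ∑ i ∈ N, MPoint t 𝒩 (fun _ => (1 : ℤ)) i
      = ((∑ i ∈ N, (separatedPairs t 𝒩 i).card : ℕ) : ℝ) := by
  rw [Finset.mul_sum, Nat.cast_sum]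
  exact Finset.sum_congr rfl fun i _ => two_mul_MPoint i

theorem IsNesting.pairs_le_sum (h : IsNesting t 𝒩) {N : Finset (Fin (n - 1))}
    (hN : PathConvex t N) : pairs t N ≤ ∑ i ∈ N, (separatedPairs t 𝒩 i).card := by
  refine (Finset.card_le_card ?_).trans Finset.card_biUnion_le
  rintro ⟨a, b⟩ hab
  obtain ⟨ha, hb, hne⟩ := Finset.mem_offDiag.1 hab
  obtain ⟨⟨e, he, -⟩, -, hl⟩ := sep_path (t := t) a b hne
  obtain ⟨i, hi, hsub⟩ := h.exists_subset_minNest ⟨e, he⟩ hl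
  exact Finset.mem_biUnion.2 ⟨i, hN a ha b hb hi, Finset.mem_filter.2 ⟨Finset.mem_offDiag.2
    ⟨left_mem_nestVtx_of_sep_subset hne hsub, right_mem_nestVtx_of_sep_subset hne hsub, hne⟩, hi⟩⟩

theorem IsMaxNesting.sum_eq_pairs (hn : 2 ≤ n) (h : IsMaxNesting t 𝒩)
    {N : Finset (Fin (n - 1))} (hN : N ∈ 𝒩) :
    ∑ i ∈ N, (separatedPairs t 𝒩 i).card = pairs t N := by
  refine le_antisymm ?_ (h.1.pairs_le_sum (h.1.1 N hN).pathConvex)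
  rw [← Finset.card_biUnion]
  · refine Finset.card_le_card (Finset.biUnion_subset.2 fun i hi => ?_)
    exact (Finset.filter_subset _ _).trans
      (Finset.offDiag_mono (nestVtx_mono (minNest_subset hN hi)))
  · intro i _ j _ hij
    refine Finset.disjoint_left.2 fun p hpi hpj => hij (h.minNest_injective hn ?_)
    obtain ⟨hi, hi'⟩ := Finset.mem_filter.1 hpi
    obtain ⟨hj, hj'⟩ := Finset.mem_filter.1 hpj
    obtain ⟨hia, hib, -⟩ := Finset.mem_offDiag.1 hi
    obtain ⟨hja, hjb, -⟩ := Finset.mem_offDiag.1 hj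
    have hconv := fun k => (h.1.1 _ (h.1.minNest_mem k)).pathConvex
    exact (minNest_subset (h.1.minNest_mem j) (hconv j _ hja _ hjb hi')).antisymm
      (minNest_subset (h.1.minNest_mem i) (hconv i _ hia _ hib hj'))

end Nestings

section HalfspaceDescription

variable {n : ℕ} {t : PTree n}

variable (t) in
/-- The polytope cut out by one equation and one inequality for each nest; it coincides with the
standard weight Loday realization. -/
def nestPolytope : Set (Vec (n - 1)) :=
  {x | 2 * ∑ i, x i = pairs t Finset.univ ∧
    ∀ N, PathConvex t N → (pairs t N : ℝ) ≤ 2 * ∑ i ∈ N, x i}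

variable (t) in
open Classical in
/-- The nests whose inequality is an equality at `x`. -/
def tightNests (x : Vec (n - 1)) : Finset (Finset (Fin (n - 1))) :=
  Finset.univ.filter fun N =>
    N.Nonempty ∧ PathConvex t N ∧ 2 * ∑ i ∈ N, x i = pairs t N

theorem mem_tightNests {x : Vec (n - 1)} {N : Finset (Fin (n - 1))} :
    N ∈ tightNests t x ↔ N.Nonempty ∧ PathConvex t N ∧ 2 * ∑ i ∈ N, x i = pairs t N := by
  simp [tightNests]

theorem isNesting_tightNests (hn : 2 ≤ n) {x : Vec (n - 1)} (hx : x ∈ nestPolytope t) :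
    IsNesting t (tightNests t x) := by
  refine ⟨fun N hN => ?_, ?_, fun N hN M hM => ?_⟩
  · obtain ⟨h₁, h₂, -⟩ := mem_tightNests.1 hN
    exact isNest_of_pathConvex h₁ h₂
  · exact mem_tightNests.2 ⟨⟨⟨0, by omega⟩, Finset.mem_univ _⟩, pathConvex_univ, hx.1⟩
  · obtain ⟨-, hNc, hNt⟩ := mem_tightNests.1 hN
    obtain ⟨-, hMc, hMt⟩ := mem_tightNests.1 hM
    by_cases hNM : N ⊆ M
    · exact Or.inl hNM
    by_cases hMN : M ⊆ N
    · exact Or.inr (Or.inl hMN)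
    have hdis : ∀ v ∈ nestVtx t N, v ∉ nestVtx t M := by
      intro v hvN hvM
      have h₁ := hx.2 _ (hNc.union hMc hvN hvM)
      have h₂ := hx.2 _ (hNc.inter hMc)
      have h₃ := pairs_add_pairs_lt hNc hMc hNM hMN
      have h₄ : ∑ i ∈ N ∪ M, x i + ∑ i ∈ N ∩ M, x i = ∑ i ∈ N, x i + ∑ i ∈ M, x i :=
        Finset.sum_union_inter
      have h₅ : (pairs t N : ℝ) + pairs t M < pairs t (N ∪ M) + pairs t (N ∩ M) := by
        exact_mod_cast h₃
      linarith
    refine Or.inr (Or.inr ⟨Finset.disjoint_left.2 fun e heN heM => ?_, fun e he f hf hef => ?_⟩)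
    · have hc : childV e ∈ ends t e := mem_ends.2 (Or.inl rfl)
      exact hdis _ (mem_nestVtx.2 ⟨e, heN, hc⟩) (mem_nestVtx.2 ⟨e, heM, hc⟩)
    · obtain ⟨-, v, hve, hvf⟩ := edgeAdj_iff.1 hef
      exact hdis v (mem_nestVtx.2 ⟨e, he, hve⟩) (mem_nestVtx.2 ⟨f, hf, hvf⟩)

theorem sum_add_smul (N : Finset (Fin (n - 1))) (x u : Vec (n - 1)) (s : ℝ) :
    ∑ i ∈ N, (x + s • u) i = ∑ i ∈ N, x i + s * ∑ i ∈ N, u i := by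
  simp [Finset.sum_add_distrib, Finset.mul_sum]

/-- One can move slightly inside the polytope in any direction tangent to all tight nests. -/
theorem eventually_add_smul_mem (hn : 2 ≤ n) {x u : Vec (n - 1)} (hx : x ∈ nestPolytope t)
    (hu : ∀ N ∈ tightNests t x, ∑ i ∈ N, u i = 0) :
    ∀ᶠ s in nhds (0 : ℝ), x + s • u ∈ nestPolytope t := by
  have hineq : ∀ N, PathConvex t N →
      ∀ᶠ s in nhds (0 : ℝ), (pairs t N : ℝ) ≤ 2 * ∑ i ∈ N, (x + s • u) i := by
    intro N hN
    simp only [sum_add_smul]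
    by_cases hT : N ∈ tightNests t x
    · simpa [hu N hT] using hx.2 N hN
    rcases N.eq_empty_or_nonempty with rfl | hne
    · simp [pairs, nestVtx]
    have hlt : (pairs t N : ℝ) < 2 * (∑ i ∈ N, x i + 0 * ∑ i ∈ N, u i) := by
      rw [zero_mul, add_zero]
      exact lt_of_le_of_ne (hx.2 N hN) fun h => hT (mem_tightNests.2 ⟨hne, hN, h.symm⟩)
    have hcont : Continuous fun s : ℝ => 2 * (∑ i ∈ N, x i + s * ∑ i ∈ N, u i) := by fun_prop
    exact (hcont.continuousAt.eventually (lt_mem_nhds hlt)).mono fun _ => le_of_lt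
  have hall := Filter.eventually_all.2 fun N => Filter.eventually_all.2 (hineq N)
  filter_upwards [hall] with s hs
  refine ⟨?_, hs⟩
  rw [sum_add_smul, hu _ (isNesting_tightNests hn hx).2.1, mul_zero, add_zero, hx.1]

/-- A direction along which one can move both ways is tangent to all tight nests. -/
theorem sum_eq_zero_of_mem_tightNests {x w : Vec (n - 1)} (h₁ : x + w ∈ nestPolytope t)
    (h₂ : x - w ∈ nestPolytope t) {N : Finset (Fin (n - 1))} (hN : N ∈ tightNests t x) :
    ∑ i ∈ N, w i = 0 := by
  obtain ⟨-, hc, ht⟩ := mem_tightNests.1 hN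
  have h₃ := h₁.2 N hc
  have h₄ := h₂.2 N hc
  simp only [Pi.add_apply, Pi.sub_apply, Finset.sum_add_distrib, Finset.sum_sub_distrib] at h₃ h₄
  linarith

theorem MPoint_mem_nestPolytope (hn : 2 ≤ n) {𝒩 : Finset (Finset (Fin (n - 1)))}
    (h : IsMaxNesting t 𝒩) : MPoint t 𝒩 (fun _ => (1 : ℤ)) ∈ nestPolytope t := by
  refine ⟨?_, fun N hN => ?_⟩
  · rw [two_mul_sum_MPoint, h.sum_eq_pairs hn h.1.2.1]
  · rw [two_mul_sum_MPoint]
    exact_mod_cast h.1.pairs_le_sum hN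

theorem convex_nestPolytope : Convex ℝ (nestPolytope t) := by
  intro x hx y hy a b ha hb hab
  have hsum : ∀ N : Finset (Fin (n - 1)), 2 * ∑ i ∈ N, (a • x + b • y) i
      = a * (2 * ∑ i ∈ N, x i) + b * (2 * ∑ i ∈ N, y i) := by
    intro N
    simp only [Pi.add_apply, Pi.smul_apply, smul_eq_mul, Finset.sum_add_distrib, ← Finset.mul_sum]
    ring
  refine ⟨?_, fun N hN => ?_⟩
  · rw [hsum, hx.1, hy.1, ← add_mul, hab, one_mul]
  · rw [hsum]
    calc (pairs t N : ℝ) = a * pairs t N + b * pairs t N := by rw [← add_mul, hab, one_mul]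
      _ ≤ _ := add_le_add (mul_le_mul_of_nonneg_left (hx.2 N hN) ha)
        (mul_le_mul_of_nonneg_left (hy.2 N hN) hb)

theorem isCompact_nestPolytope : IsCompact (nestPolytope t) := by
  have hclosed : IsClosed (nestPolytope t) := by
    have hinter : nestPolytope t = {x : Vec (n - 1) | 2 * ∑ i, x i = pairs t Finset.univ} ∩
        ⋂ (N) (_ : PathConvex t N), {x : Vec (n - 1) | (pairs t N : ℝ) ≤ 2 * ∑ i ∈ N, x i} := by
      ext x
      simp [nestPolytope]
    rw [hinter]
    exact (isClosed_eq (by fun_prop) continuous_const).inter (isClosed_iInter fun N =>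
      isClosed_iInter fun _ => isClosed_le continuous_const (by fun_prop))
  refine isCompact_Icc.of_isClosed_subset hclosed
    (s := Set.Icc (0 : Vec (n - 1)) fun _ => (pairs t Finset.univ : ℝ) / 2) fun x hx => ?_
  have hnonneg : ∀ i, 0 ≤ x i := by
    intro i
    have := hx.2 {i} (pathConvex_singleton i)
    rw [Finset.sum_singleton] at this
    have h₀ : (0 : ℝ) ≤ pairs t {i} := Nat.cast_nonneg _
    linarith
  refine ⟨hnonneg, fun i => ?_⟩
  have := Finset.single_le_sum (fun j _ => hnonneg j) (Finset.mem_univ i)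
  have := hx.1
  simp only
  linarith

theorem minNest_tightNests_injective (hn : 2 ≤ n) {x : Vec (n - 1)}
    (hx : x ∈ (nestPolytope t).extremePoints ℝ) :
    Function.Injective (minNest (tightNests t x)) := by
  intro i j hij
  by_contra hne
  have hT := isNesting_tightNests hn hx.1
  let u : Vec (n - 1) := Pi.single i 1 - Pi.single j 1
  have hu : ∀ N ∈ tightNests t x, ∑ k ∈ N, u k = 0 := by
    intro N hN
    have hmem : i ∈ N ↔ j ∈ N :=
      ⟨fun hi => minNest_subset hN hi (hij ▸ hT.mem_minNest j),
        fun hj => minNest_subset hN hj (hij ▸ hT.mem_minNest i)⟩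
    simp [u, Finset.sum_sub_distrib, hmem]
  have hev := eventually_add_smul_mem hn hx.1 hu
  have hneg : Filter.Tendsto (fun s : ℝ => -s) (nhds 0) (nhds 0) := by
    simpa using (continuous_neg (G := ℝ)).tendsto 0
  obtain ⟨s, ⟨hs₁, hs₂⟩, hs⟩ := ((hev.and (hneg.eventually hev)).filter_mono
    nhdsWithin_le_nhds |>.and (self_mem_nhdsWithin (s := Set.Ioi (0 : ℝ)))).exists
  have := (mem_extremePoints.1 hx).2 _ hs₁ _ hs₂
    ⟨1 / 2, 1 / 2, by norm_num, by norm_num, by norm_num, by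
      ext k
      simp only [Pi.add_apply, Pi.smul_apply, smul_eq_mul]
      ring⟩
  have h₁ := congrFun this.1 i
  simp only [u, Pi.add_apply, Pi.smul_apply, Pi.sub_apply, Pi.single_eq_same,
    Pi.single_eq_of_ne hne, smul_eq_mul] at h₁
  have : (0 : ℝ) < s := hs
  linarith

theorem Loday_eq_nestPolytope (hn : 2 ≤ n) : Loday t (fun _ => (1 : ℤ)) = nestPolytope t := by
  refine (convexHull_min ?_ convex_nestPolytope).antisymm ?_
  · rintro x ⟨𝒩, h, rfl⟩
    exact MPoint_mem_nestPolytope hn h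
  · rw [← closure_convexHull_extremePoints isCompact_nestPolytope convex_nestPolytope]
    have hfin : {x | ∃ 𝒩, IsMaxNesting t 𝒩 ∧ x = MPoint t 𝒩 fun _ => (1 : ℤ)}.Finite :=
      (Set.finite_range fun 𝒩 => MPoint t 𝒩 fun _ => (1 : ℤ)).subset
        fun x ⟨𝒩, _, hx⟩ => ⟨𝒩, hx.symm⟩
    refine closure_minimal (convexHull_mono fun x hx => ?_) (hfin.isClosed_convexHull ℝ)
    have hT := isNesting_tightNests hn hx.1
    have hinj := minNest_tightNests_injective hn hx
    have hmax := hT.isMaxNesting hn hinj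
    refine ⟨tightNests t x, hmax, ?_⟩
    refine sub_eq_zero.1 (hT.eq_zero_of_injective hinj fun N hN => ?_)
    have h₁ := (mem_tightNests.1 hN).2.2
    have h₂ := two_mul_sum_MPoint (t := t) (𝒩 := tightNests t x) N
    rw [hmax.sum_eq_pairs hn hN] at h₂
    simp only [Pi.sub_apply, Finset.sum_sub_distrib]
    linarith

end HalfspaceDescription

section PositiveOrientation

variable {n : ℕ} {t : PTree n}

/-- Any common direction of motion at two points of the polytope can be replaced by a nonzero
balanced trinary one. -/
theorem exists_trinary_direction (hn : 2 ≤ n) {x y w : Vec (n - 1)} (hw : w ≠ 0)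
    (hx : x ∈ nestPolytope t) (hy : y ∈ nestPolytope t)
    (hx₁ : x + w ∈ nestPolytope t) (hx₂ : x - w ∈ nestPolytope t)
    (hy₁ : y + w ∈ nestPolytope t) (hy₂ : y - w ∈ nestPolytope t) :
    ∃ u : Vec (n - 1), u ≠ 0 ∧ Trinary u ∧ ∑ i, u i = 0 ∧ ∃ s : ℝ, 0 < s ∧
      x + s • u ∈ nestPolytope t ∧ x + (-s) • u ∈ nestPolytope t ∧
      y + s • u ∈ nestPolytope t ∧ y + (-s) • u ∈ nestPolytope t := by
  have hTx := isNesting_tightNests hn hx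
  have hTy := isNesting_tightNests hn hy
  obtain ⟨u, hu₀, hu, hub⟩ := exists_trinary_of_sum_fiber_eq_zero
    (fun p => if p then minNest (tightNests t x) else minNest (tightNests t y)) w hw (by
      rintro (_ | _) b
      · simpa using hTy.sum_block_eq_zero (fun N => sum_eq_zero_of_mem_tightNests hy₁ hy₂) b
      · simpa using hTx.sum_block_eq_zero (fun N => sum_eq_zero_of_mem_tightNests hx₁ hx₂) b)
  have hux : ∀ N ∈ tightNests t x, ∑ i ∈ N, u i = 0 :=
    fun N => hTx.sum_nest_eq_zero (by simpa using hub true)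
  have huy : ∀ N ∈ tightNests t y, ∑ i ∈ N, u i = 0 :=
    fun N => hTy.sum_nest_eq_zero (by simpa using hub false)
  have hev := (eventually_add_smul_mem hn hx hux).and (eventually_add_smul_mem hn hy huy)
  have hneg : Filter.Tendsto (fun s : ℝ => -s) (nhds 0) (nhds 0) := by
    simpa using (continuous_neg (G := ℝ)).tendsto 0
  obtain ⟨s, ⟨⟨h₁, h₂⟩, h₃, h₄⟩, hs⟩ := ((hev.and (hneg.eventually hev)).filter_mono
    nhdsWithin_le_nhds |>.and (self_mem_nhdsWithin (s := Set.Ioi (0 : ℝ)))).exists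
  exact ⟨u, hu₀, hu, hux _ hTx.2.1, s, hs, h₁, h₃, h₂, h₄⟩

theorem mem_reflP {m : ℕ} {z x : Vec m} {P : Set (Vec m)} :
    x ∈ reflP z P ↔ (2 : ℝ) • z - x ∈ P := by
  constructor
  · rintro ⟨y, hy, rfl⟩
    simpa using hy
  · exact fun h => ⟨_, h, by simp⟩

theorem convex_reflP {m : ℕ} {P : Set (Vec m)} (hP : Convex ℝ P) (z : Vec m) :
    Convex ℝ (reflP z P) := by
  intro x hx y hy a b ha hb hab
  rw [mem_reflP] at *
  convert hP hx hy ha hb hab using 1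
  rw [smul_sub, smul_sub, sub_add_sub_comm, ← add_smul, hab, one_smul]

/-- Between two distinct points of `P ∩ ρ_z P` the midpoint has a balanced trinary direction of
motion. -/
theorem exists_trinary_at_midpoint (hn : 2 ≤ n) {z a b : Vec (n - 1)}
    (ha : a ∈ nestPolytope t ∩ reflP z (nestPolytope t))
    (hb : b ∈ nestPolytope t ∩ reflP z (nestPolytope t)) (hab : a ≠ b) :
    ∃ u : Vec (n - 1), u ≠ 0 ∧ Trinary u ∧ ∑ i, u i = 0 ∧ ∃ s : ℝ, 0 < s ∧
      midpoint ℝ a b + s • u ∈ nestPolytope t ∩ reflP z (nestPolytope t) ∧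
      midpoint ℝ a b + (-s) • u ∈ nestPolytope t ∩ reflP z (nestPolytope t) := by
  have hm := (convex_nestPolytope.inter (convex_reflP convex_nestPolytope z)).midpoint_mem ha hb
  set w : Vec (n - 1) := (1 / 2 : ℝ) • (b - a) with hw
  have hmid : midpoint ℝ a b = (1 / 2 : ℝ) • (a + b) := by
    rw [midpoint_eq_smul_add]
    norm_num
  have hma : midpoint ℝ a b - w = a := by
    rw [hmid, hw]
    module
  have hmb : midpoint ℝ a b + w = b := by
    rw [hmid, hw]
    module
  have hw₀ : w ≠ 0 := by
    intro h0
    rw [h0, sub_zero] at hma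
    rw [h0, add_zero] at hmb
    exact hab (hma.symm.trans hmb)
  obtain ⟨u, hu₀, hu, hsum, s, hs, h₁, h₂, h₃, h₄⟩ := exists_trinary_direction hn hw₀ hm.1
    (mem_reflP.1 hm.2) (by rw [hmb]; exact hb.1) (by rw [hma]; exact ha.1)
    (by rw [sub_add, hma]; exact mem_reflP.1 ha.2)
    (by rw [sub_sub, hmb]; exact mem_reflP.1 hb.2)
  refine ⟨u, hu₀, hu, hsum, s, hs, ⟨h₁, mem_reflP.2 ?_⟩, ⟨h₂, mem_reflP.2 ?_⟩⟩
  · rwa [← sub_sub, sub_eq_add_neg, ← neg_smul]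
  · rwa [neg_smul, ← sub_eq_add_neg, sub_sub_eq_add_sub, add_sub_right_comm]

theorem dot_add_smul {m : ℕ} (c x u : Vec m) (s : ℝ) :
    dot c (x + s • u) = dot c x + s * dot c u := by
  simp only [dot, Finset.mul_sum, ← Finset.sum_add_distrib]
  refine Finset.sum_congr rfl fun i _ => ?_
  simp only [Pi.add_apply, Pi.smul_apply, smul_eq_mul]
  ring

theorem dot_comm {m : ℕ} (x y : Vec m) : dot x y = dot y x := by
  simp only [dot, mul_comm]

/-- A vector outside the fundamental arrangement is not orthogonal to a balanced trinary vector. -/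
theorem dot_ne_zero_of_trinary {m : ℕ} {u v : Vec m}
    (hv : ∀ I J : Finset (Fin m), DPair I J → (∑ i ∈ I, v i) ≠ ∑ j ∈ J, v j)
    (hu₀ : u ≠ 0) (hu : Trinary u) (hsum : ∑ i, u i = 0) : dot v u ≠ 0 := by
  set I := Finset.univ.filter fun i => u i = 1 with hI
  set J := Finset.univ.filter fun i => u i = -1 with hJ
  have hdec : ∀ i, u i = (if u i = 1 then 1 else 0) - (if u i = -1 then 1 else 0) := by
    intro i
    rcases hu i with h | h | h <;> rw [h] <;> norm_num
  have hdot : ∀ c : Vec m, dot c u = ∑ i ∈ I, c i - ∑ i ∈ J, c i := by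
    intro c
    simp only [dot, hI, hJ, Finset.sum_filter, ← Finset.sum_sub_distrib]
    refine Finset.sum_congr rfl fun i _ => ?_
    conv_lhs => rw [hdec i]
    split_ifs <;> ring
  have hcard : I.card = J.card := by
    have h := hdot fun _ => 1
    simp only [dot, one_mul, hsum, Finset.sum_const, nsmul_eq_mul, mul_one] at h
    have : (I.card : ℝ) = J.card := by linarith
    exact_mod_cast this
  have hdis : Disjoint I J := by
    refine Finset.disjoint_left.2 fun i hi hj => ?_
    have h₁ := (Finset.mem_filter.1 hi).2
    rw [(Finset.mem_filter.1 hj).2] at h₁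
    norm_num at h₁
  have hne : (I ∪ J).Nonempty := by
    obtain ⟨i, hi⟩ := Function.ne_iff.1 hu₀
    refine ⟨i, ?_⟩
    have := (hu i).resolve_left hi
    simpa [hI, hJ] using this
  rw [hdot]
  have hmin := (I ∪ J).min'_mem hne
  have hle : ∀ x ∈ I ∪ J, (I ∪ J).min' hne ≤ x := fun x hx => Finset.min'_le _ x hx
  rcases Finset.mem_union.1 hmin with h | h
  · exact sub_ne_zero.2 (hv I J ⟨hcard, hdis, _, h, hle⟩)
  · exact sub_ne_zero.2 (hv J I ⟨hcard.symm, hdis.symm, _, h, by rwa [Finset.union_comm]⟩).symm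

variable {v : Vec (n - 1)}

theorem oriented_inter_reflP (hn : 2 ≤ n)
    (hv : ∀ I J : Finset (Fin (n - 1)), DPair I J → (∑ i ∈ I, v i) ≠ ∑ j ∈ J, v j)
    (z : Vec (n - 1)) : Oriented (nestPolytope t ∩ reflP z (nestPolytope t)) v := by
  rintro E ⟨⟨c, rfl⟩, hdim⟩ d hd hd₀
  set R := nestPolytope t ∩ reflP z (nestPolytope t) with hR
  set E := {x ∈ R | ∀ y ∈ R, dot c y ≤ dot c x} with hE
  have hnt : E.Nontrivial := by
    by_contra h
    rw [Set.not_nontrivial_iff] at h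
    rw [sdim, direction_affineSpan, vectorSpan_of_subsingleton ℝ h, finrank_bot] at hdim
    exact zero_ne_one hdim
  obtain ⟨a, ha, b, hb, hab⟩ := hnt
  obtain ⟨u, hu₀, hu, hsum, s, hs, h₁, h₂⟩ := exists_trinary_at_midpoint hn ha.1 hb.1 hab
  have hmR : midpoint ℝ a b ∈ R :=
    (convex_nestPolytope.inter (convex_reflP convex_nestPolytope z)).midpoint_mem ha.1 hb.1
  have hmE : midpoint ℝ a b ∈ E := by
    refine ⟨hmR, fun y hy => ?_⟩
    have hmid : midpoint ℝ a b = a + (1 / 2 : ℝ) • (b - a) := by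
      rw [midpoint_eq_smul_add, invOf_eq_inv]
      module
    have hdiff : dot c (b - a) = dot c b - dot c a := by
      simp [dot, mul_sub]
    rw [hmid, dot_add_smul, hdiff]
    have := ha.2 y hy
    have := hb.2 y hy
    linarith
  have hcu : dot c u = 0 := by
    have h₃ := hmE.2 _ h₁
    have h₄ := hmE.2 _ h₂
    rw [dot_add_smul] at h₃ h₄
    nlinarith
  have hsE : midpoint ℝ a b + s • u ∈ E := by
    refine ⟨h₁, fun y hy => ?_⟩
    rw [dot_add_smul, hcu, mul_zero, add_zero]
    exact hmE.2 y hy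
  have hud : u ∈ (affineSpan ℝ E).direction := by
    rw [direction_affineSpan]
    have := Submodule.smul_mem _ s⁻¹ (vsub_mem_vectorSpan ℝ hsE hmE)
    rwa [vsub_eq_sub, add_sub_cancel_left, smul_smul, inv_mul_cancel₀ hs.ne', one_smul] at this
  obtain ⟨r, hr⟩ := (finrank_eq_one_iff_of_nonzero' (⟨d, hd⟩ : (affineSpan ℝ E).direction)
    fun h => hd₀ (congrArg Subtype.val h)).1 hdim ⟨u, hud⟩
  have hr' : r • d = u := congrArg Subtype.val hr
  intro h0
  refine dot_ne_zero_of_trinary hv hu₀ hu hsum ?_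
  have := dot_add_smul v 0 d r
  rw [zero_add, hr', dot_comm v d, h0] at this
  simpa [dot] using this

theorem existsUnique_isTopOf (hn : 2 ≤ n)
    (hv : ∀ I J : Finset (Fin (n - 1)), DPair I J → (∑ i ∈ I, v i) ≠ ∑ j ∈ J, v j)
    {z : Vec (n - 1)} (hz : z ∈ nestPolytope t) :
    ∃! x, IsTopOf (nestPolytope t ∩ reflP z (nestPolytope t)) v x := by
  have hcomp : IsCompact (nestPolytope t ∩ reflP z (nestPolytope t)) :=
    isCompact_nestPolytope.inter (isCompact_nestPolytope.image (by fun_prop))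
  have hne : (nestPolytope t ∩ reflP z (nestPolytope t)).Nonempty :=
    ⟨z, hz, mem_reflP.2 (by rwa [two_smul, add_sub_cancel_right])⟩
  have hcont : Continuous fun x : Vec (n - 1) => dot v x := by
    unfold dot
    fun_prop
  obtain ⟨x, hx, hmax⟩ := hcomp.exists_isMaxOn hne hcont.continuousOn
  refine ⟨x, ⟨hx, fun y hy => hmax hy⟩, fun y hy => ?_⟩
  by_contra hyx
  obtain ⟨u, hu₀, hu, hsum, s, hs, h₁, h₂⟩ := exists_trinary_at_midpoint hn hx hy.1 (Ne.symm hyx)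
  refine dot_ne_zero_of_trinary hv hu₀ hu hsum ?_
  have hmid : midpoint ℝ x y = x + (1 / 2 : ℝ) • (y - x) := by
    rw [midpoint_eq_smul_add, invOf_eq_inv]
    module
  have hdiff : dot v (y - x) = dot v y - dot v x := by
    simp [dot, mul_sub]
  have h₃ : dot v x ≤ dot v y := hy.2 x hx
  have h₄ : dot v (midpoint ℝ x y + s • u) ≤ dot v x := hmax h₁
  have h₅ : dot v (midpoint ℝ x y + (-s) • u) ≤ dot v x := hmax h₂
  rw [hmid, dot_add_smul, dot_add_smul, hdiff] at h₄ h₅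
  nlinarith

theorem dot_neg_left {m : ℕ} (x y : Vec m) : dot (-x) y = -dot x y := by
  simp [dot]

theorem isBotOf_iff_isTopOf_neg {m : ℕ} {P : Set (Vec m)} {v x : Vec m} :
    IsBotOf P v x ↔ IsTopOf P (-v) x := by
  simp only [IsBotOf, IsTopOf, dot_neg_left, neg_le_neg_iff]

end PositiveOrientation

/-- For a planar tree `t ∈ PT_n` with standard weight Loday realization
`P_t ⊆ ℝ^{n-1}`, any vector `v` with `Σ_{i ∈ I} v_i ≠ Σ_{j ∈ J} v_j` for all
`(I, J) ∈ D(n-1)` positively orients `P_t`, and hence defines a bot-top diagonal: `⟨-, v⟩` has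
a unique minimizer and a unique maximizer on `P_t ∩ ρ_z P_t` for every `z ∈ P_t`. -/
theorem stmt17 {n : ℕ} (hn : 2 ≤ n) (t : PTree n) (v : Vec (n - 1))
    (hv : ∀ I J : Finset (Fin (n - 1)), DPair I J → (∑ i ∈ I, v i) ≠ ∑ j ∈ J, v j) :
    PosOriented (Loday t fun _ => (1 : ℤ)) v ∧
    QuasiPosOriented (Loday t fun _ => (1 : ℤ)) v := by
  rw [Loday_eq_nestPolytope hn]
  refine ⟨fun z _ => oriented_inter_reflP hn hv z, fun z hz => ⟨?_, existsUnique_isTopOf hn hv hz⟩⟩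
  simp only [isBotOf_iff_isTopOf_neg]
  refine existsUnique_isTopOf hn (fun I J hIJ h => hv I J hIJ ?_) hz
  simpa using h
end
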